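/- Let L be a prime number and let b : {0,…,L−1} → {0,…,d−1} satisfy ∑_{i=0}^{L−1} b_i ≡ 0 (mod d) with b not identically zero. Then Tr(ρ_T · ∏_{i=0}^{L−1} Z_i^{b_i}) = d(L−1) / (d^L + d(L−1)), where Z is the generalized Pauli clock matrix and Z_i acts on site i. -/

import Mathlib

open scoped BigOperators

noncomputable section

/-- Cyclic shift by one site: `(shift σ) i = σ (i - 1)`. -/
def shift (d L : ℕ) (σ : ZMod L → Fin d) : ZMod L → Fin d := fun i => σ (i - 1)

/-- The translation operator `T` on `H = (ℂ^d)^{⊗L}`. -/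
def Tmat (d L : ℕ) [NeZero L] : Matrix (ZMod L → Fin d) (ZMod L → Fin d) ℂ :=
  Matrix.of fun τ σ => if τ = shift d L σ then 1 else 0

/-- The projector `P_T = (1/L)·∑_{k=0}^{L−1} T^k`. -/
def Pmat (d L : ℕ) [NeZero L] : Matrix (ZMod L → Fin d) (ZMod L → Fin d) ℂ :=
  (L : ℂ)⁻¹ • ∑ k ∈ Finset.range L, Tmat d L ^ k

/-- The maximally mixed invariant state of translation, `ρ_T = P_T / Tr(P_T)`. -/
def rhoT (d L : ℕ) [NeZero L] : Matrix (ZMod L → Fin d) (ZMod L → Fin d) ℂ :=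
  ((Pmat d L).trace)⁻¹ • Pmat d L

/-- The operator `O_i`: a single-site operator `O` acting on site `i`, tensored with
the identity on all other sites. -/
def siteOp (d L : ℕ) [NeZero L] (O : Matrix (Fin d) (Fin d) ℂ) (i : ZMod L) :
    Matrix (ZMod L → Fin d) (ZMod L → Fin d) ℂ :=
  Matrix.of fun τ σ => O (τ i) (σ i) * if (∀ j, j ≠ i → τ j = σ j) then 1 else 0

/-- The generalized Pauli clock matrix `Z`, with `Z|q⟩ = ω^q |q⟩`, `ω = exp(2πi/d)`. -/
def Zmat (d : ℕ) : Matrix (Fin d) (Fin d) ℂ :=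
  Matrix.diagonal fun q => Complex.exp (2 * Real.pi * Complex.I / d) ^ (q : ℕ)

/-- The product `∏_{i=0}^{L−1} Z_i^{b_i}` of the commuting operators `Z_i^{b_i}`. -/
def prodZ (d L : ℕ) [NeZero L] (b : ZMod L → Fin d) :
    Matrix (ZMod L → Fin d) (ZMod L → Fin d) ℂ :=
  (((List.range L).map fun i =>
    siteOp d L (Zmat d ^ ((b ((i : ℕ) : ZMod L)) : ℕ)) ((i : ℕ) : ZMod L))).prod

theorem Tmat_pow_apply (d L : ℕ) [NeZero L] (k : ℕ) (τ σ : ZMod L → Fin d) :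
    (Tmat d L ^ k) τ σ = if τ = (fun i => σ (i - k)) then 1 else 0 := by
  induction k generalizing σ with
  | zero => simp [Matrix.one_apply]
  | succ k ih =>
    have h : (fun i : ZMod L => shift d L σ (i - k)) = fun i => σ (i - (k + 1 : ℕ)) := by
      funext i
      simp [shift, sub_sub]
    simp_rw [pow_succ, Matrix.mul_apply, ih, ← h, Tmat, Matrix.of_apply]
    simp

theorem siteOp_diagonal (d L : ℕ) [NeZero L] (f : Fin d → ℂ) (i : ZMod L) :
    siteOp d L (Matrix.diagonal f) i = Matrix.diagonal fun σ => f (σ i) := by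
  ext τ σ
  by_cases h : τ = σ
  · subst h
    simp [siteOp]
  · rw [Matrix.diagonal_apply_ne _ h]
    simp only [siteOp, Matrix.of_apply, mul_ite, mul_one, mul_zero, ite_eq_right_iff]
    intro hj
    refine Matrix.diagonal_apply_ne _ fun hi => h (funext fun j => ?_)
    by_cases hji : j = i
    · rw [hji, hi]
    · exact hj j hji

theorem prod_range_natCast_zmod {M : Type*} [CommMonoid M] (L : ℕ) [NeZero L] (f : ZMod L → M) :
    ∏ k ∈ Finset.range L, f (k : ZMod L) = ∏ i, f i := by
  refine Finset.prod_bij (fun k _ => (k : ZMod L)) (by simp) ?_ ?_ (by simp)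
  · intro a ha c hc h
    have := congrArg ZMod.val h
    rwa [ZMod.val_cast_of_lt (Finset.mem_range.1 ha),
      ZMod.val_cast_of_lt (Finset.mem_range.1 hc)] at this
  · intro i _
    exact ⟨i.val, Finset.mem_range.2 i.val_lt, ZMod.natCast_zmod_val i⟩

theorem List.prod_map_diagonal {ι n R : Type*} [Fintype n] [DecidableEq n] [CommSemiring R]
    (l : List ι) (f : ι → n → R) :
    (l.map fun i => Matrix.diagonal (f i)).prod
      = Matrix.diagonal fun x => (l.map fun i => f i x).prod := by
  induction l with
  | nil => simp
  | cons a l ih => simp [ih, Matrix.diagonal_mul_diagonal]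

theorem prodZ_eq_diagonal (d L : ℕ) [NeZero L] (b : ZMod L → Fin d) :
    prodZ d L b = Matrix.diagonal fun σ => ∏ i,
      (Complex.exp (2 * Real.pi * Complex.I / d) ^ (σ i : ℕ)) ^ (b i : ℕ) := by
  simp only [prodZ, Zmat, Matrix.diagonal_pow, siteOp_diagonal, List.prod_map_diagonal]
  congr 1
  funext σ
  rw [← prod_range_natCast_zmod L fun i =>
    (Complex.exp (2 * Real.pi * Complex.I / d) ^ (σ i : ℕ)) ^ (b i : ℕ)]
  rfl

theorem trace_Tmat_pow_mul_diagonal (d L : ℕ) [NeZero L] (k : ℕ) (f : (ZMod L → Fin d) → ℂ) :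
    (Tmat d L ^ k * Matrix.diagonal f).trace
      = ∑ σ : ZMod L → Fin d, if σ = (fun i => σ (i - k)) then f σ else 0 := by
  simp [Matrix.trace, Matrix.mul_diagonal, Tmat_pow_apply]

theorem eq_shift_iff_const {α : Type*} {L k : ℕ} (hL : L.Prime) (hk : 0 < k) (hkL : k < L)
    (σ : ZMod L → α) : σ = (fun i => σ (i - k)) ↔ ∃ q, Function.const _ q = σ := by
  have : Fact L.Prime := ⟨hL⟩
  constructor
  · intro h
    have key : ∀ n : ℕ, σ (n * k : ZMod L) = σ 0 := by
      intro n
      induction n with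
      | zero => simp
      | succ n ih =>
        rw [← ih, congrFun h]
        congr 1
        push_cast
        ring
    have hk0 : (k : ZMod L) ≠ 0 := by
      rw [Ne, ZMod.natCast_eq_zero_iff]
      exact Nat.not_dvd_of_pos_of_lt hk hkL
    refine ⟨σ 0, funext fun i => ?_⟩
    have := key (i / k : ZMod L).val
    rw [ZMod.natCast_zmod_val, div_mul_cancel₀ _ hk0] at this
    exact this.symm
  · rintro ⟨q, rfl⟩
    rfl

theorem trace_Tmat_pow_mul_diagonal_of_pos (d L : ℕ) [NeZero L] (hL : L.Prime) {k : ℕ}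
    (hk : 0 < k) (hkL : k < L) (f : (ZMod L → Fin d) → ℂ) :
    (Tmat d L ^ k * Matrix.diagonal f).trace = ∑ q, f (Function.const _ q) := by
  classical
  simp only [trace_Tmat_pow_mul_diagonal, eq_shift_iff_const hL hk hkL]
  rw [← Finset.sum_filter]
  symm
  refine Finset.sum_bij (fun q _ => Function.const _ q) (by simp) ?_ (by simp) (by simp)
  intro a _ c _ h
  exact congrFun h 0

theorem trace_Pmat_mul_diagonal (d L : ℕ) [NeZero L] (hL : L.Prime)
    (f : (ZMod L → Fin d) → ℂ) :
    (Pmat d L * Matrix.diagonal f).trace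
      = (L : ℂ)⁻¹ * (∑ σ, f σ + ((L : ℂ) - 1) * ∑ q, f (Function.const _ q)) := by
  obtain ⟨n, rfl⟩ := Nat.exists_eq_succ_of_ne_zero hL.ne_zero
  rw [Pmat, smul_mul_assoc, Matrix.trace_smul, smul_eq_mul, Finset.sum_mul, Matrix.trace_sum,
    Finset.sum_range_succ']
  rw [Finset.sum_congr rfl fun k hk => trace_Tmat_pow_mul_diagonal_of_pos d _ hL k.succ_pos
    (Nat.succ_lt_succ (Finset.mem_range.1 hk)) f]
  simp [Matrix.trace_diagonal, add_comm]

theorem trace_Pmat (d L : ℕ) [NeZero L] (hL : L.Prime) :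
    (Pmat d L).trace = (L : ℂ)⁻¹ * ((d : ℂ) ^ L + (d : ℂ) * ((L : ℂ) - 1)) := by
  have h := trace_Pmat_mul_diagonal d L hL 1
  rw [show Matrix.diagonal (1 : (ZMod L → Fin d) → ℂ) = 1 from Matrix.diagonal_one, mul_one] at h
  rw [h]
  simp [ZMod.card, mul_comm]

theorem IsPrimitiveRoot.sum_fin_pow_eq_zero {R : Type*} [CommRing R] [IsDomain R] {ω : R} {d : ℕ}
    (hω : IsPrimitiveRoot ω d) {m : ℕ} (hm : m ≠ 0) (hmd : m < d) :
    ∑ q : Fin d, (ω ^ (q : ℕ)) ^ m = 0 := by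
  have h1 : ω ^ m - 1 ≠ 0 := sub_ne_zero.2 (hω.pow_ne_one_of_pos_of_lt hm hmd)
  refine (mul_eq_zero.1 ?_).resolve_right h1
  simp_rw [pow_right_comm ω _ m]
  rw [Fin.sum_univ_eq_sum_range fun q => (ω ^ m) ^ q, geom_sum_mul, pow_right_comm, hω.pow_eq_one,
    one_pow, sub_self]

/-- for `L` prime and `b : {0,…,L−1} → {0,…,d−1}` with
`∑ b_i ≡ 0 (mod d)` and `b` not identically zero,
`Tr(ρ_T · ∏_i Z_i^{b_i}) = d(L−1)/(d^L + d(L−1))`. -/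
theorem stmt16 (d L : ℕ) [NeZero L] (hd : 2 ≤ d) (hL : L.Prime)
    (b : ZMod L → Fin d) (hb : (d : ℕ) ∣ ∑ i, (b i : ℕ)) (hb0 : ∃ i, (b i : ℕ) ≠ 0) :
    (rhoT d L * prodZ d L b).trace
      = ((d : ℂ) * ((L : ℂ) - 1)) / ((d : ℂ) ^ L + (d : ℂ) * ((L : ℂ) - 1)) := by
  have hω := Complex.isPrimitiveRoot_exp d (by omega)
  have hsum : ∑ σ : ZMod L → Fin d, ∏ i,
      (Complex.exp (2 * Real.pi * Complex.I / d) ^ (σ i : ℕ)) ^ (b i : ℕ) = 0 := by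
    obtain ⟨i, hi⟩ := hb0
    rw [← Fintype.prod_sum fun i (q : Fin d) =>
      (Complex.exp (2 * Real.pi * Complex.I / d) ^ (q : ℕ)) ^ (b i : ℕ)]
    exact Finset.prod_eq_zero (Finset.mem_univ i) (hω.sum_fin_pow_eq_zero hi (b i).isLt)
  have hconst (q : Fin d) : ∏ i, (Complex.exp (2 * Real.pi * Complex.I / d) ^
      ((Function.const (ZMod L) q i : Fin d) : ℕ)) ^ (b i : ℕ) = 1 := by
    simp only [Function.const_apply]
    rw [Finset.prod_pow_eq_pow_sum, pow_right_comm, (hω.pow_eq_one_iff_dvd _).2 hb, one_pow]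
  have hL0 : (L : ℂ) ≠ 0 := Nat.cast_ne_zero.2 hL.ne_zero
  rw [rhoT, smul_mul_assoc, Matrix.trace_smul, smul_eq_mul, prodZ_eq_diagonal,
    trace_Pmat_mul_diagonal d L hL, trace_Pmat d L hL, hsum]
  simp only [hconst, Finset.sum_const, Finset.card_univ, Fintype.card_fin, nsmul_eq_mul, mul_one,
    zero_add, mul_inv, inv_inv]
  field_simp
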